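/- arXiv:0706.0014 — 5 statements merged into one kernel-verified Lean document; each statement's English description precedes it below -/
import Mathlib

section
/- Let M and N be positive integers and u an integer. Suppose a₁, b₁, a₂, b₂ are integers such that for each i ∈ {1,2}: 2·|aᵢ| < N, 0 < bᵢ, N·bᵢ ≤ M, and M divides aᵢ − bᵢ·u. Then a₁·b₂ = a₂·b₁, i.e., the fractions a₁/b₁ and a₂/b₂ coincide as rational numbers. (Uniqueness of the solution to the rational reconstruction problem with numerator bound N/2 and denominator bound M/N.) -/
/-- Uniqueness of the solution to the rational reconstruction problem with
numerator bound `N/2` and denominator bound `M/N`: if `a₁/b₁` and `a₂/b₂`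
both satisfy `2·|aᵢ| < N`, `0 < bᵢ`, `N·bᵢ ≤ M` and `aᵢ ≡ bᵢ·u (mod M)`,
then the two fractions coincide. -/
theorem rational_reconstruction_unique
    (M N u a₁ b₁ a₂ b₂ : ℤ) (hM : 0 < M) (hN : 0 < N)
    (ha₁ : 2 * |a₁| < N) (hb₁ : 0 < b₁) (hb₁' : N * b₁ ≤ M)
    (hc₁ : M ∣ a₁ - b₁ * u)
    (ha₂ : 2 * |a₂| < N) (hb₂ : 0 < b₂) (hb₂' : N * b₂ ≤ M)
    (hc₂ : M ∣ a₂ - b₂ * u) :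
    a₁ * b₂ = a₂ * b₁ := by
  have hdvd : M ∣ a₁ * b₂ - a₂ * b₁ := by
    have h := (hc₁.mul_right b₂).sub (hc₂.mul_right b₁)
    rwa [show (a₁ - b₁ * u) * b₂ - (a₂ - b₂ * u) * b₁ = a₁ * b₂ - a₂ * b₁ by ring] at h
  have cross_lt {a b : ℤ} (ha : 2 * |a| < N) (hb : 0 < b) (hbM : N * b ≤ M) :
      2 * |a * b| < M := by
    rw [abs_mul, abs_of_pos hb, ← mul_assoc]
    exact (mul_lt_mul_of_pos_right ha hb).trans_le hbM
  have hlt : |a₁ * b₂ - a₂ * b₁| < M := by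
    linarith [abs_sub (a₁ * b₂) (a₂ * b₁), cross_lt ha₁ hb₂ hb₂', cross_lt ha₂ hb₁ hb₁']
  exact sub_eq_zero.mp (Int.eq_zero_of_abs_lt_dvd hdvd hlt)
end

section
/- Let M be a positive integer and let n, d, u be integers with d > 0, 2·n² < M, 2·d² < M, and M dividing n − d·u. Then for all integers a, b with 2·a² ≤ M, 0 < b, 2·b² ≤ M, and M dividing a − b·u, one has a·d = b·n; that is, any fraction a/b with numerator and denominator at most √(M/2) in absolute value that is congruent to u modulo M equals n/d. (Correctness of Wang's early-terminated rational reconstruction: the reconstruction with bounds √(M/2) is guaranteed to return the true fraction n/d as soon as M > 2·max(n², d²).) -/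
/-- Correctness of Wang's early-terminated rational reconstruction: if the
true fraction `n/d` satisfies `2·n² < M` and `2·d² < M` (i.e. `M > 2·max(n², d²)`)
and `n ≡ d·u (mod M)`, then any fraction `a/b` with numerator and denominator
bounded by `√(M/2)` that is congruent to `u` modulo `M` equals `n/d`. -/
theorem wang_early_termination_correct
    (M n d u : ℤ) (hM : 0 < M) (hd : 0 < d)
    (hn2 : 2 * n ^ 2 < M) (hd2 : 2 * d ^ 2 < M)
    (hcong : M ∣ n - d * u) :
    ∀ a b : ℤ, 2 * a ^ 2 ≤ M → 0 < b → 2 * b ^ 2 ≤ M → M ∣ a - b * u →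
      a * d = b * n := by
  intro a b ha _ hb hab
  have hdvd : M ∣ a * d - b * n := by
    have h := dvd_sub (hab.mul_left d) (hcong.mul_left b)
    have e : d * (a - b * u) - b * (n - d * u) = a * d - b * n := by ring
    rwa [e] at h
  have habs : |a * d - b * n| < M := by
    rw [abs_lt]
    constructor
    · nlinarith [sq_nonneg (a + d), sq_nonneg (b - n)]
    · nlinarith [sq_nonneg (a - d), sq_nonneg (b + n)]
  exact sub_eq_zero.mp (Int.eq_zero_of_abs_lt_dvd hdvd habs)
end

section
/- For every m ≥ 1, the determinant of the m×m Hilbert matrix H_m satisfies 1/det(H_m) = ∏_{k=1}^{m−1} (2k+1)·(C(2k,k))², where C(2k,k) is the central binomial coefficient; equivalently, det(H_m) = (∏_{k=1}^{m−1} (2k+1)·(C(2k,k))²)⁻¹. -/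
/-- Expansion of a determinant around a nonzero bottom right entry, in terms of its Schur
complement. -/
theorem Matrix.det_succ_eq_mul_det_schur_last {K : Type*} [Field K] {n : ℕ}
    (A : Matrix (Fin (n + 1)) (Fin (n + 1)) K) (h : A (Fin.last n) (Fin.last n) ≠ 0) :
    A.det = A (Fin.last n) (Fin.last n) * (Matrix.of fun i j : Fin n =>
      A i.castSucc j.castSucc -
        A i.castSucc (Fin.last n) / A (Fin.last n) (Fin.last n) * A (Fin.last n) j.castSucc).det := by
  let c : Fin (n + 1) → K :=
    Fin.lastCases 0 fun i => A i.castSucc (Fin.last n) / A (Fin.last n) (Fin.last n)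
  have hc : c (Fin.last n) = 0 := by simp [c]
  have hc' (i : Fin n) :
      c i.castSucc = A i.castSucc (Fin.last n) / A (Fin.last n) (Fin.last n) := by simp [c]
  rw [Matrix.det_eq_of_forall_row_eq_smul_add_const
    (B := Matrix.of fun i j => A i j - c i * A (Fin.last n) j) c (Fin.last n) hc
    (fun i j => by simp [hc]), Matrix.det_succ_column _ (Fin.last n), Fin.sum_univ_castSucc,
    Finset.sum_eq_zero fun i _ => by simp [hc', h]]
  have hs : (-1 : K) ^ (n + n) = 1 := Even.neg_one_pow ⟨n, rfl⟩
  simp only [Matrix.of_apply, hc, Fin.val_last, hs, Fin.succAbove_last]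
  rw [zero_mul, sub_zero, one_mul, zero_add]
  congr 2
  ext i j
  simp [hc']

theorem Nat.cast_centralBinom_mul_prod_range {K : Type*} [Field K] [CharZero K] (n : ℕ) :
    (n.centralBinom : K) * ∏ i ∈ Finset.range n, ((n : K) - i) / (i + n + 1) = 1 := by
  have hnum : ∏ i ∈ Finset.range n, ((n : K) - i) = n.factorial := by
    rw [← Nat.descFactorial_self, Nat.descFactorial_eq_prod_range, Nat.cast_prod]
    exact Finset.prod_congr rfl fun i hi => by
      rw [Nat.cast_sub (Finset.mem_range.mp hi).le]
  have hden : ∏ i ∈ Finset.range n, ((i : K) + n + 1) = (n + 1).ascFactorial n := by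
    rw [Nat.ascFactorial_eq_prod_range, Nat.cast_prod]
    exact Finset.prod_congr rfl fun i _ => by push_cast; ring
  have hasc : ((n + 1).ascFactorial n : K) ≠ 0 := by
    exact_mod_cast (Nat.ascFactorial_pos n n).ne'
  rw [Finset.prod_div_distrib, hnum, hden, ← mul_div_assoc, div_eq_one_iff_eq hasc,
    Nat.centralBinom, two_mul, mul_comm]
  exact_mod_cast (Nat.ascFactorial_eq_factorial_mul_choose n n).symm

theorem det_hilbert_succ (m : ℕ) :
    (Matrix.of fun i j : Fin (m + 1) => 1 / ((i : ℕ) + (j : ℕ) + 1 : ℚ)).det =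
      ((2 * m + 1) * (m.centralBinom : ℚ) ^ 2)⁻¹ *
        (Matrix.of fun i j : Fin m => 1 / ((i : ℕ) + (j : ℕ) + 1 : ℚ)).det := by
  let v : Fin m → ℚ := fun i => ((m : ℚ) - (i : ℕ)) / ((i : ℕ) + m + 1)
  have hv : ∏ i, v i = (m.centralBinom : ℚ)⁻¹ := by
    refine eq_inv_of_mul_eq_one_right ?_
    rw [Fin.prod_univ_eq_prod_range (fun i : ℕ => ((m : ℚ) - i) / (i + m + 1))]
    exact Nat.cast_centralBinom_mul_prod_range m
  have hschur : (Matrix.of fun i j : Fin m =>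
      1 / ((i : ℕ) + (j : ℕ) + 1 : ℚ) -
        1 / ((i : ℕ) + m + 1) / (1 / ((m : ℚ) + m + 1)) * (1 / (m + (j : ℕ) + 1))) =
      Matrix.of fun i j => v i * Matrix.of (fun i j : Fin m =>
        v j * Matrix.of (fun i j : Fin m => 1 / ((i : ℕ) + (j : ℕ) + 1 : ℚ)) i j) i j := by
    ext i j
    simp only [Matrix.of_apply, v]
    field_simp
    ring
  rw [Matrix.det_succ_eq_mul_det_schur_last _ (by simp only [Matrix.of_apply]; positivity)]
  simp only [Matrix.of_apply, Fin.val_last, Fin.val_castSucc]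
  rw [hschur, Matrix.det_mul_column, Matrix.det_mul_row, hv]
  field_simp
  ring

theorem det_hilbert (m : ℕ) :
    (Matrix.of fun i j : Fin m => 1 / ((i : ℕ) + (j : ℕ) + 1 : ℚ)).det =
      (∏ k ∈ Finset.range m, ((2 * k + 1) * (k.centralBinom : ℚ) ^ 2))⁻¹ := by
  induction m with
  | zero => simp
  | succ m ih => rw [det_hilbert_succ, ih, Finset.prod_range_succ, mul_comm, ← mul_inv]

/-- The classical formula for the determinant of the `m×m` Hilbert matrix
`H_m = [1/(i+j+1)]`: its reciprocal is `∏_{k=1}^{m-1} (2k+1)·(C(2k,k))²`. -/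
theorem hilbert_det_formula
    (m : ℕ) (hm : 1 ≤ m)
    (H : Matrix (Fin m) (Fin m) ℚ)
    (hH : ∀ i j : Fin m, H i j = 1 / ((i : ℕ) + (j : ℕ) + 1 : ℚ)) :
    (H.det)⁻¹ =
        ∏ k ∈ Finset.Ico 1 m, ((2 * k + 1) * (Nat.choose (2 * k) k) ^ 2 : ℚ) ∧
      H.det =
        (∏ k ∈ Finset.Ico 1 m, ((2 * k + 1) * (Nat.choose (2 * k) k) ^ 2 : ℚ))⁻¹ := by
  have hdet : H.det =
      (∏ k ∈ Finset.Ico 1 m, ((2 * k + 1) * (Nat.choose (2 * k) k) ^ 2 : ℚ))⁻¹ := by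
    rw [show H = Matrix.of fun i j : Fin m => 1 / ((i : ℕ) + (j : ℕ) + 1 : ℚ) from
      Matrix.ext hH, det_hilbert, Finset.range_eq_Ico,
      Finset.prod_eq_prod_Ico_succ_bot (by omega)]
    simp [Nat.centralBinom]
  exact ⟨by rw [hdet, inv_inv], hdet⟩
end

section
/- For every m ≥ 1, the determinant of the m×m Hilbert matrix H_m is positive and its numerator in lowest terms equals 1; that is, det(H_m) = 1/d for some positive integer d. -/
namespace HilbertMatrix

/-- The ratio `i!² / ((i - k)! (i + k)!)` of binomial coefficients, equal to `0` for `i < k`. -/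
def binomRatio (i k : ℕ) : ℚ := ∏ l ∈ Finset.range k, ((i : ℚ) - l) / (i + l + 1)

theorem binomRatio_succ (i k : ℕ) :
    binomRatio i (k + 1) = binomRatio i k * (((i : ℚ) - k) / (i + k + 1)) :=
  Finset.prod_range_succ _ _

theorem binomRatio_eq_zero {i k : ℕ} (h : i < k) : binomRatio i k = 0 :=
  Finset.prod_eq_zero (Finset.mem_range.2 h) (by simp)

theorem binomRatio_mul_centralBinom {i k : ℕ} (h : k ≤ i) :
    binomRatio i k * i.centralBinom = (2 * i).choose (i + k) := by
  induction k with
  | zero => simp [binomRatio, Nat.centralBinom]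
  | succ k ih =>
    have hc := Nat.choose_succ_right_eq (2 * i) (i + k)
    rw [show 2 * i - (i + k) = i - k by omega] at hc
    have hq : ((2 * i).choose (i + k + 1) : ℚ) * (i + k + 1)
        = (2 * i).choose (i + k) * (i - k) := by
      rw [← Nat.cast_sub (by omega : k ≤ i)]
      exact_mod_cast hc
    have h0 : (i : ℚ) + k + 1 ≠ 0 := by positivity
    rw [binomRatio_succ, mul_right_comm, ih (by omega), ← mul_div_assoc, div_eq_iff h0, ← hq,
      add_assoc i k 1]

theorem binomRatio_self (k : ℕ) : binomRatio k k = 1 / k.centralBinom := by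
  have h0 : (k.centralBinom : ℚ) ≠ 0 := by exact_mod_cast k.centralBinom_ne_zero
  rw [eq_div_iff h0, binomRatio_mul_centralBinom le_rfl, ← two_mul, Nat.choose_self, Nat.cast_one]

theorem sum_binomRatio_mul (i j m : ℕ) :
    ∑ k ∈ Finset.range m, binomRatio i k / (i + k + 1) * (2 * k + 1) *
        (binomRatio j k / (j + k + 1)) =
      (1 - binomRatio i m * binomRatio j m) / (i + j + 1) := by
  induction m with
  | zero => simp [binomRatio]
  | succ m ih =>
    rw [Finset.sum_range_succ, ih, binomRatio_succ, binomRatio_succ]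
    have h1 : (i : ℚ) + m + 1 ≠ 0 := by positivity
    have h2 : (j : ℚ) + m + 1 ≠ 0 := by positivity
    have h3 : (i : ℚ) + j + 1 ≠ 0 := by positivity
    field_simp
    ring

/-- The lower triangular factor of the Hilbert matrix; its entries are the moments
`∫ x in 0..1, x ^ i * P k x` of the shifted Legendre polynomials. -/
def legendreMoment (m : ℕ) : Matrix (Fin m) (Fin m) ℚ :=
  .of fun i k => binomRatio i k / ((i : ℕ) + (k : ℕ) + 1)

theorem det_legendreMoment (m : ℕ) :
    (legendreMoment m).det = ∏ k : Fin m, 1 / ((2 * (k : ℕ) + 1) * (k : ℕ).centralBinom : ℚ) := by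
  rw [Matrix.det_of_isLowerTriangular]
  · refine Finset.prod_congr rfl fun k _ => ?_
    rw [legendreMoment, Matrix.of_apply, binomRatio_self, div_div, ← two_mul, mul_comm]
  · intro i j hij
    rw [legendreMoment, Matrix.of_apply, binomRatio_eq_zero (by simpa using hij), zero_div]

theorem eq_legendreMoment_mul {m : ℕ} {H : Matrix (Fin m) (Fin m) ℚ}
    (hH : ∀ i j : Fin m, H i j = 1 / ((i : ℕ) + (j : ℕ) + 1 : ℚ)) :
    H = legendreMoment m * Matrix.diagonal (fun k : Fin m => (2 * (k : ℕ) + 1 : ℚ)) *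
      (legendreMoment m).transpose := by
  ext i j
  rw [Matrix.mul_apply]
  simp only [Matrix.mul_diagonal, Matrix.transpose_apply, legendreMoment,
    Matrix.of_apply]
  rw [hH, Fin.sum_univ_eq_sum_range (fun k => binomRatio i k / ((i : ℕ) + k + 1) * (2 * k + 1) *
    (binomRatio j k / ((j : ℕ) + k + 1))) m, sum_binomRatio_mul, binomRatio_eq_zero i.isLt]
  simp

theorem det_eq_one_div_prod {m : ℕ} {H : Matrix (Fin m) (Fin m) ℚ}
    (hH : ∀ i j : Fin m, H i j = 1 / ((i : ℕ) + (j : ℕ) + 1 : ℚ)) :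
    H.det = 1 / ((∏ k : Fin m, (2 * (k : ℕ) + 1) * (k : ℕ).centralBinom ^ 2 : ℕ) : ℚ) := by
  rw [eq_legendreMoment_mul hH, Matrix.det_mul, Matrix.det_mul, Matrix.det_transpose,
    Matrix.det_diagonal, det_legendreMoment, ← Finset.prod_mul_distrib, ← Finset.prod_mul_distrib,
    Nat.cast_prod, one_div, ← Finset.prod_inv_distrib]
  refine Finset.prod_congr rfl fun k _ => ?_
  have h0 : ((k : ℕ).centralBinom : ℚ) ≠ 0 := by exact_mod_cast (k : ℕ).centralBinom_ne_zero
  push_cast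
  field_simp

end HilbertMatrix

/-- The determinant of the `m×m` Hilbert matrix is positive and has numerator `1`
in lowest terms; that is, it equals `1/d` for some positive integer `d`. -/
theorem hilbert_det_pos_num_one
    (m : ℕ) (hm : 1 ≤ m)
    (H : Matrix (Fin m) (Fin m) ℚ)
    (hH : ∀ i j : Fin m, H i j = 1 / ((i : ℕ) + (j : ℕ) + 1 : ℚ)) :
    0 < H.det ∧ H.det.num = 1 ∧ ∃ d : ℤ, 0 < d ∧ H.det = 1 / (d : ℚ) := by
  have hdet := HilbertMatrix.det_eq_one_div_prod hH
  have hpos : 0 < ∏ k : Fin m, (2 * (k : ℕ) + 1) * (k : ℕ).centralBinom ^ 2 :=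
    Finset.prod_pos fun k _ => Nat.mul_pos (Nat.succ_pos _) (pow_pos (k : ℕ).centralBinom_pos 2)
  generalize ∏ k : Fin m, (2 * (k : ℕ) + 1) * (k : ℕ).centralBinom ^ 2 = d at hdet hpos
  rw [hdet]
  refine ⟨by positivity, ?_, d, by exact_mod_cast hpos, by simp⟩
  rw [one_div, Rat.inv_natCast_num_of_pos hpos]
end

section
/- For every m ≥ 1, the reciprocal of the determinant of the m×m Hilbert matrix H_m satisfies 16^(m(m−1)/2) / (2m)^m ≤ 1/det(H_m) ≤ 16^(m(m−1)/2) · (2m)^m. (In particular the bit size log(1/det(H_m)) grows like Θ(m²), consistent with the estimate that log(1/det(H_m)) is O(m² log m) used in the complexity analysis.) -/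
/-- The Hilbert matrix, with entries `1 / (i + j + 1)`. -/
def hilbertMatrix (m : ℕ) : Matrix (Fin m) (Fin m) ℚ :=
  Matrix.of fun i j ↦ 1 / ((i : ℕ) + (j : ℕ) + 1 : ℚ)

open Finset in
theorem prod_sub_div_add_eq_inv_centralBinom (n : ℕ) :
    ∏ i : Fin n, (((n : ℚ) - (i : ℕ)) / ((i : ℕ) + n + 1)) = (n.centralBinom : ℚ)⁻¹ := by
  have hnum : ∏ i ∈ range n, ((n : ℚ) - i) = n.factorial := by
    rw [← prod_range_add_one_eq_factorial, ← prod_range_reflect, Nat.cast_prod]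
    refine prod_congr rfl fun i hi ↦ ?_
    have h : ((n - 1 - i : ℕ) : ℚ) + i + 1 = n := by
      have : n - 1 - i + i + 1 = n := by grind
      exact_mod_cast this
    rw [Nat.cast_succ]
    linarith
  have hden : ∏ i ∈ range n, ((i : ℚ) + n + 1) = (n.factorial : ℚ) * n.centralBinom := by
    have h := Nat.ascFactorial_eq_factorial_mul_choose n n
    rw [Nat.ascFactorial_eq_prod_range, ← two_mul, ← Nat.centralBinom_eq_two_mul_choose] at h
    rw [← Nat.cast_mul, ← h, Nat.cast_prod]
    refine prod_congr rfl fun i _ ↦ ?_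
    push_cast
    ring
  rw [Fin.prod_univ_eq_prod_range (fun i : ℕ ↦ ((n : ℚ) - i) / (i + n + 1)) n,
    prod_div_distrib, hnum, hden]
  have := n.factorial_ne_zero
  field_simp

/-- Schur complement at the last entry. -/
theorem det_hilbertMatrix_succ (n : ℕ) :
    (hilbertMatrix (n + 1)).det =
      (hilbertMatrix n).det / ((2 * n + 1) * (n.centralBinom : ℚ) ^ 2) := by
  let d : Fin n → ℚ := fun i ↦ ((n : ℚ) - (i : ℕ)) / ((i : ℕ) + n + 1)
  let c : Matrix (Fin 1) (Fin 1) ℚ := Matrix.of fun _ _ ↦ 1 / (2 * n + 1 : ℚ)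
  have hn : (2 * n + 1 : ℚ) ≠ 0 := by positivity
  let inst : Invertible c :=
    ⟨Matrix.of fun _ _ ↦ (2 * n + 1 : ℚ),
      by ext i j; simp [c, Matrix.mul_apply, Matrix.one_apply, Subsingleton.elim i j, hn],
      by ext i j; simp [c, Matrix.mul_apply, Matrix.one_apply, Subsingleton.elim i j, hn]⟩
  have hinv (a b : Fin 1) : (⅟c) a b = 2 * n + 1 := rfl
  have hblocks : (hilbertMatrix (n + 1)).submatrix finSumFinEquiv finSumFinEquiv =
      Matrix.fromBlocks (hilbertMatrix n) (Matrix.of fun i _ ↦ 1 / ((i : ℕ) + n + 1 : ℚ))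
        (Matrix.of fun _ j ↦ 1 / ((n : ℚ) + (j : ℕ) + 1)) c := by
    ext (i | i) (j | j) <;> simp [hilbertMatrix, c, two_mul]
  have hschur : hilbertMatrix n -
      (Matrix.of fun (i : Fin n) (_ : Fin 1) ↦ 1 / ((i : ℕ) + n + 1 : ℚ)) * ⅟c *
        (Matrix.of fun (_ : Fin 1) (j : Fin n) ↦ 1 / ((n : ℚ) + (j : ℕ) + 1)) =
      Matrix.diagonal d * hilbertMatrix n * Matrix.diagonal d := by
    ext i j
    have h1 : ((i : ℕ) + (j : ℕ) + 1 : ℚ) ≠ 0 := by positivity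
    have h2 : ((i : ℕ) + n + 1 : ℚ) ≠ 0 := by positivity
    have h3 : ((j : ℕ) + n + 1 : ℚ) ≠ 0 := by positivity
    rw [Matrix.mul_diagonal, Matrix.diagonal_mul]
    simp only [Matrix.sub_apply, Matrix.mul_apply, hilbertMatrix, d, Matrix.of_apply, hinv,
      Finset.univ_unique, Finset.sum_singleton]
    rw [add_comm (n : ℚ) (j : ℕ)]
    field_simp
    ring
  rw [← Matrix.det_submatrix_equiv_self finSumFinEquiv, hblocks, Matrix.det_fromBlocks₂₂, hschur,
    Matrix.det_mul, Matrix.det_mul, Matrix.det_diagonal, prod_sub_div_add_eq_inv_centralBinom,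
    Matrix.det_unique]
  have := n.centralBinom_ne_zero
  simp only [c, Matrix.of_apply]
  field_simp

theorem inv_det_hilbertMatrix (m : ℕ) :
    (hilbertMatrix m).det⁻¹ =
      ∏ k ∈ Finset.range m, ((2 * k + 1) * (k.centralBinom : ℚ) ^ 2) := by
  induction m with
  | zero => simp
  | succ n ih => rw [det_hilbertMatrix_succ, Finset.prod_range_succ, ← ih, inv_div,
      div_eq_mul_inv, mul_comm]

theorem prod_sixteen_pow (m : ℕ) :
    ∏ k ∈ Finset.range m, (16 : ℚ) ^ k = 16 ^ (m * (m - 1) / 2) := by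
  rw [Finset.prod_pow_eq_pow_sum, Finset.sum_range_id]

theorem sixteen_pow_le_mul_centralBinom_sq (k : ℕ) :
    16 ^ k ≤ (2 * (k + 1)) * ((2 * k + 1) * k.centralBinom ^ 2) := by
  rcases Nat.eq_zero_or_pos k with rfl | hk
  · simp
  · calc 16 ^ k = (4 ^ k) ^ 2 := by rw [← pow_mul, mul_comm, pow_mul]; norm_num
      _ ≤ (2 * k * k.centralBinom) ^ 2 := by
        gcongr
        exact Nat.four_pow_le_two_mul_self_mul_centralBinom k hk
      _ = (2 * k) * ((2 * k) * k.centralBinom ^ 2) := by ring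
      _ ≤ _ := by gcongr <;> omega

theorem centralBinom_sq_le_sixteen_pow (k : ℕ) : k.centralBinom ^ 2 ≤ 16 ^ k :=
  calc k.centralBinom ^ 2 ≤ (4 ^ k) ^ 2 := by gcongr; exact k.centralBinom_le_four_pow
    _ = 16 ^ k := by rw [← pow_mul, mul_comm, pow_mul]; norm_num


/-- Size estimate for the reciprocal of the Hilbert determinant:
`16^(m(m−1)/2) / (2m)^m ≤ 1/det(H_m) ≤ 16^(m(m−1)/2) · (2m)^m`. -/
theorem hilbert_det_reciprocal_bounds
    (m : ℕ) (hm : 1 ≤ m)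
    (H : Matrix (Fin m) (Fin m) ℚ)
    (hH : ∀ i j : Fin m, H i j = 1 / ((i : ℕ) + (j : ℕ) + 1 : ℚ)) :
    (16 : ℚ) ^ (m * (m - 1) / 2) / ((2 * m : ℕ) : ℚ) ^ m ≤ (H.det)⁻¹ ∧
      (H.det)⁻¹ ≤ (16 : ℚ) ^ (m * (m - 1) / 2) * ((2 * m : ℕ) : ℚ) ^ m := by
  obtain rfl : H = hilbertMatrix m := by
    ext i j
    exact hH i j
  rw [inv_det_hilbertMatrix, ← prod_sixteen_pow, div_le_iff₀ (by positivity)]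
  have hconst : ((2 * m : ℕ) : ℚ) ^ m = ∏ _k ∈ Finset.range m, ((2 * m : ℕ) : ℚ) := by simp
  rw [hconst, ← Finset.prod_mul_distrib, ← Finset.prod_mul_distrib]
  constructor
  · refine Finset.prod_le_prod (fun _ _ ↦ by positivity) fun k hk ↦ ?_
    have hkm : k + 1 ≤ m := Finset.mem_range.mp hk
    have h : 16 ^ k ≤ ((2 * k + 1) * k.centralBinom ^ 2) * (2 * m) :=
      (sixteen_pow_le_mul_centralBinom_sq k).trans (by rw [mul_comm]; gcongr)
    exact_mod_cast h
  · refine Finset.prod_le_prod (fun _ _ ↦ by positivity) fun k hk ↦ ?_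
    have hkm : k < m := Finset.mem_range.mp hk
    have h : (2 * k + 1) * k.centralBinom ^ 2 ≤ 16 ^ k * (2 * m) := by
      rw [mul_comm]
      exact Nat.mul_le_mul (centralBinom_sq_le_sixteen_pow k) (by omega)
    exact_mod_cast h
end
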